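/- Let Σ ⊆ ℝ^d be a d-simplex, let S be a flag simplex of Σ, and let z ∈ int Σ. Then for every p ∈ int Σ, the limit lim_{R→∞} Vol^B_{int Σ}(AsB_{int Σ}(z,R) ∩ S)/R^d exists and equals (1/(d+1)!) · liminf_{R→∞} Vol^B_{int Σ}(B_{int Σ}(p,R))/R^d. -/

import Mathlib

open Filter Set MeasureTheory Metric
open scoped ENNReal Topology Pointwise RealInnerProductSpace

noncomputable section
open scoped Classical

abbrev Euc (d : ℕ) := EuclideanSpace ℝ (Fin d)

/-- The Hilbert distance on a bounded open convex set `U`. -/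
def hilbertDist {d : ℕ} (U : Set (Euc d)) (p q : Euc d) : ℝ :=
  if p = q then 0
  else
    (1 / 2) * Real.log
      (((1 - sInf {t : ℝ | p + t • (q - p) ∈ U}) / (- sInf {t : ℝ | p + t • (q - p) ∈ U})) *
        (sSup {t : ℝ | p + t • (q - p) ∈ U} / (sSup {t : ℝ | p + t • (q - p) ∈ U} - 1)))

/-- The closed Hilbert ball. -/
def hilbertBall {d : ℕ} (U : Set (Euc d)) (p : Euc d) (R : ℝ) : Set (Euc d) :=
  {q ∈ U | hilbertDist U p q ≤ R}

/-- The Finsler (Hilbert) norm `F_U(p, v)`. -/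
def finslerNorm {d : ℕ} (U : Set (Euc d)) (p v : Euc d) : ℝ :=
  if v = 0 then 0
  else (1 / 2) * (1 / sSup {t : ℝ | 0 < t ∧ p + t • v ∈ U}
                + 1 / sSup {t : ℝ | 0 < t ∧ p - t • v ∈ U})

/-- The unit ball `β_U(p)` of the Finsler norm. -/
def finslerUnitBall {d : ℕ} (U : Set (Euc d)) (p : Euc d) : Set (Euc d) :=
  {v | finslerNorm U p v < 1}

/-- The Busemann volume of `A ⊆ U`. -/
def busemannVol {d : ℕ} (U : Set (Euc d)) (A : Set (Euc d)) : ℝ≥0∞ :=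
  ∫⁻ p in A, volume (Metric.ball (0 : Euc d) 1) / volume (finslerUnitBall U p)

/-- The polar body `K°`. -/
def polarSet {d : ℕ} (K : Set (Euc d)) : Set (Euc d) :=
  {y | ∀ v ∈ K, ⟪v, y⟫ ≤ (1 : ℝ)}

/-- The Holmes–Thompson volume of `A ⊆ U`. -/
def htVol {d : ℕ} (U : Set (Euc d)) (A : Set (Euc d)) : ℝ≥0∞ :=
  ∫⁻ p in A, volume (polarSet (finslerUnitBall U p)) / volume (Metric.ball (0 : Euc d) 1)

/-- The asymptotic ball `AsB_U(y, R)`. -/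
def asympBall {d : ℕ} (U : Set (Euc d)) (y : Euc d) (R : ℝ) : Set (Euc d) :=
  if 0 < R then (fun u => y + (1 - Real.exp (-2 * R)) • (u - y)) '' U else ∅

/-- `F` is a face of the compact convex set `P`. -/
def IsFace {d : ℕ} (P F : Set (Euc d)) : Prop :=
  F.Nonempty ∧ IsClosed F ∧ Convex ℝ F ∧ IsExtreme ℝ P F

/-- The dimension of a set: the dimension of its affine span. -/
def faceDim {d : ℕ} (F : Set (Euc d)) : ℕ :=
  Module.finrank ℝ (affineSpan ℝ F).direction

/-- The set of maximal flags of a `dm`-dimensional polytope `P ⊆ ℝ^d`. -/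
def flagSet {d : ℕ} (dm : ℕ) (P : Set (Euc d)) : Set (Fin (dm + 1) → Set (Euc d)) :=
  {f | (∀ i, IsFace P (f i) ∧ faceDim (f i) = (i : ℕ)) ∧
       ∀ i j : Fin (dm + 1), i ≤ j → f i ⊆ f j}

/-- `N(ε, Ω)`: the least number of maximal flags of a `d`-dimensional polytope within
Hausdorff distance `ε` of `Ω`. -/
def flagNumber (d : ℕ) (Ω : Set (Euc d)) (ε : ℝ) : ℕ :=
  sInf {n | ∃ V : Finset (Euc d), V.Nonempty ∧
    faceDim (convexHull ℝ (V : Set (Euc d))) = d ∧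
    Metric.hausdorffDist (convexHull ℝ (V : Set (Euc d))) Ω ≤ ε ∧
    (flagSet d (convexHull ℝ (V : Set (Euc d)))).ncard = n}

/-- The flag approximability `a_f(Ω)`. -/
def flagApprox (d : ℕ) (Ω : Set (Euc d)) : ℝ :=
  liminf (fun ε : ℝ => Real.log (flagNumber d Ω ε) / (- Real.log ε)) (𝓝[>] 0)

/-- `s` is a `dm`-simplex. -/
def IsSimplexSet {d : ℕ} (dm : ℕ) (s : Set (Euc d)) : Prop :=
  ∃ v : Fin (dm + 1) → Euc d, AffineIndependent ℝ v ∧ s = convexHull ℝ (Set.range v)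

/-- `S` is a flag simplex of the `dm`-dimensional polytope `P`. -/
def IsFlagSimplex {d : ℕ} (dm : ℕ) (P S : Set (Euc d)) : Prop :=
  ∃ f ∈ flagSet dm P, ∃ v : Fin (dm + 1) → Euc d, AffineIndependent ℝ v ∧
    S = convexHull ℝ (Set.range v) ∧ ∀ i, v i ∈ intrinsicInterior ℝ (f i)

/-- The Macbeath region `M'(x)`. -/
def macbeath {d : ℕ} (Ω : Set (Euc d)) (x : Euc d) : Set (Euc d) :=
  (fun v => x + v) ''
    (((5 : ℝ)⁻¹ • ((fun w => w - x) '' Ω)) ∩ ((5 : ℝ)⁻¹ • ((fun w => x - w) '' Ω)))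

/-- The Funk distance with respect to the convex body `Ω`. -/
def funkDist {d : ℕ} (Ω : Set (Euc d)) (p q : Euc d) : ℝ :=
  if p = q then 0
  else Real.log (sSup {t : ℝ | p + t • (q - p) ∈ Ω} /
        (sSup {t : ℝ | p + t • (q - p) ∈ Ω} - 1))

/-! ### Logarithmic coordinates -/

/-- Coordinates extended by `0` in position `0`. -/
def extL {d : ℕ} (k : Fin (d + 1)) : Euc d →L[ℝ] ℝ :=
  Fin.cases 0 (fun i => EuclideanSpace.proj i) k

lemma extL_zero {d : ℕ} (y : Euc d) : extL (0 : Fin (d + 1)) y = 0 := rfl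

lemma extL_succ {d : ℕ} (i : Fin d) (y : Euc d) : extL i.succ y = y i := rfl

lemma comb_coord {d : ℕ} (b : AffineBasis (Fin (d + 1)) ℝ (Euc d)) (c : Fin (d + 1) → ℝ)
    (hc : ∑ j, c j = 1) (k : Fin (d + 1)) : b.coord k (∑ j, c j • b j) = c k := by
  rw [← Finset.affineCombination_eq_linear_combination _ _ _ hc]
  exact b.coord_apply_combination_of_mem (Finset.mem_univ k) hc

/-- The normalising sum. -/
def smZ {d : ℕ} (y : Euc d) : ℝ := ∑ j : Fin (d + 1), Real.exp (extL j y)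

lemma smZ_pos {d : ℕ} (y : Euc d) : 0 < smZ y :=
  Finset.sum_pos (fun _ _ => Real.exp_pos _) Finset.univ_nonempty

lemma one_le_smZ {d : ℕ} (y : Euc d) : 1 ≤ smZ y := by
  have := Finset.single_le_sum (f := fun j : Fin (d + 1) => Real.exp (extL j y))
    (fun _ _ => (Real.exp_pos _).le) (Finset.mem_univ 0)
  simpa [extL_zero, smZ] using this

/-- Softmax coordinates. -/
def sm {d : ℕ} (y : Euc d) (k : Fin (d + 1)) : ℝ := Real.exp (extL k y) / smZ y

lemma sm_pos {d : ℕ} (y : Euc d) (k : Fin (d + 1)) : 0 < sm y k :=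
  div_pos (Real.exp_pos _) (smZ_pos y)

lemma sm_sum {d : ℕ} (y : Euc d) : ∑ k, sm y k = 1 := by
  simp only [sm]
  rw [← Finset.sum_div]
  exact div_self (smZ_pos y).ne'

/-- The parametrisation of the open simplex by logarithmic coordinates. -/
def Phi {d : ℕ} (b : AffineBasis (Fin (d + 1)) ℝ (Euc d)) (y : Euc d) : Euc d :=
  ∑ k, sm y k • b k

lemma coord_Phi {d : ℕ} (b : AffineBasis (Fin (d + 1)) ℝ (Euc d)) (y : Euc d)
    (k : Fin (d + 1)) : b.coord k (Phi b y) = sm y k :=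
  comb_coord b _ (sm_sum y) k

/-- The open simplex. -/
def opS {d : ℕ} (b : AffineBasis (Fin (d + 1)) ℝ (Euc d)) : Set (Euc d) :=
  {x | ∀ i, 0 < b.coord i x}

lemma Phi_mem {d : ℕ} (b : AffineBasis (Fin (d + 1)) ℝ (Euc d)) (y : Euc d) :
    Phi b y ∈ opS b := fun i => by rw [coord_Phi]; exact sm_pos y i

/-- Inverse of `Phi`. -/
def Psi {d : ℕ} (b : AffineBasis (Fin (d + 1)) ℝ (Euc d)) (x : Euc d) : Euc d :=
  WithLp.toLp 2 (fun i : Fin d => Real.log (b.coord i.succ x / b.coord 0 x))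

lemma exp_extL_Psi {d : ℕ} (b : AffineBasis (Fin (d + 1)) ℝ (Euc d)) {x : Euc d}
    (hx : x ∈ opS b) (k : Fin (d + 1)) :
    Real.exp (extL k (Psi b x)) = b.coord k x / b.coord 0 x := by
  refine Fin.cases ?_ (fun i => ?_) k
  · rw [extL_zero, div_self (hx 0).ne', Real.exp_zero]
  · rw [extL_succ]
    exact Real.exp_log (div_pos (hx _) (hx _))

lemma sm_Psi {d : ℕ} (b : AffineBasis (Fin (d + 1)) ℝ (Euc d)) {x : Euc d}
    (hx : x ∈ opS b) (k : Fin (d + 1)) : sm (Psi b x) k = b.coord k x := by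
  have h0 := (hx 0).ne'
  have h1 : smZ (Psi b x) = 1 / b.coord 0 x := by
    simp only [smZ, exp_extL_Psi b hx]
    rw [← Finset.sum_div, b.sum_coord_apply_eq_one]
  rw [sm, h1, exp_extL_Psi b hx]
  field_simp

lemma Phi_Psi {d : ℕ} (b : AffineBasis (Fin (d + 1)) ℝ (Euc d)) {x : Euc d}
    (hx : x ∈ opS b) : Phi b (Psi b x) = x := by
  simp only [Phi, sm_Psi b hx]
  exact b.linear_combination_coord_eq_self x

lemma extL_ext {d : ℕ} {y y' : Euc d} (h : ∀ k : Fin (d + 1), extL k y = extL k y') : y = y' := by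
  ext i
  exact h i.succ

lemma Phi_inj {d : ℕ} (b : AffineBasis (Fin (d + 1)) ℝ (Euc d)) :
    Function.Injective (Phi b) := by
  intro y y' h
  have h1 : ∀ k, sm y k = sm y' k := fun k => by rw [← coord_Phi b, ← coord_Phi b, h]
  have hZ : smZ y = smZ y' := by
    have := h1 0
    simp only [sm, extL_zero, Real.exp_zero] at this
    exact inv_injective (by simpa using this)
  refine extL_ext fun k => ?_
  have := h1 k
  simp only [sm, hZ] at this
  exact Real.exp_injective (by
    have hp := (smZ_pos y').ne'
    field_simp at this
    exact this)

/-- Weights of the derivative. -/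
def dw {d : ℕ} (y w : Euc d) (k : Fin (d + 1)) : ℝ :=
  sm y k * (extL k w - ∑ j, sm y j * extL j w)

lemma dw_sum {d : ℕ} (y w : Euc d) : ∑ k, dw y w k = 0 := by
  simp only [dw, mul_sub, Finset.sum_sub_distrib]
  rw [← Finset.sum_mul, sm_sum]
  ring

/-- Derivative of `Phi`. -/
def DPhi {d : ℕ} (b : AffineBasis (Fin (d + 1)) ℝ (Euc d)) (y : Euc d) : Euc d →L[ℝ] Euc d :=
  ∑ k, (sm y k • (extL k - ∑ j, sm y j • extL j)).smulRight (b k)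

lemma DPhi_apply {d : ℕ} (b : AffineBasis (Fin (d + 1)) ℝ (Euc d)) (y w : Euc d) :
    DPhi b y w = ∑ k, dw y w k • b k := by
  simp [DPhi, dw]

lemma hasFDerivAt_Phi {d : ℕ} (b : AffineBasis (Fin (d + 1)) ℝ (Euc d)) (y : Euc d) :
    HasFDerivAt (Phi b) (DPhi b y) y := by
  have he : ∀ k : Fin (d + 1), HasFDerivAt (fun y : Euc d => Real.exp (extL k y))
      (Real.exp (extL k y) • extL k) y := fun k => (extL k).hasFDerivAt.exp
  have hZ : HasFDerivAt (smZ (d := d)) (∑ k, Real.exp (extL k y) • extL k) y :=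
    HasFDerivAt.fun_sum fun k _ => he k
  have hs : ∀ k : Fin (d + 1), HasFDerivAt (fun y : Euc d => sm y k)
      (sm y k • (extL k - ∑ j, sm y j • extL j)) y := by
    intro k
    have h := (he k).mul ((hasDerivAt_inv (smZ_pos y).ne').comp_hasFDerivAt y hZ)
    refine h.congr_fderiv ?_
    refine ContinuousLinearMap.ext fun w => ?_
    have hp := (smZ_pos y).ne'
    simp only [sm, smul_apply, sub_apply,
      add_apply, sum_apply, smul_eq_mul, Function.comp]
    have : ∑ x : Fin (d+1), Real.exp (extL x y) / smZ y * extL x w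
        = (∑ x : Fin (d+1), Real.exp (extL x y) * extL x w) / smZ y := by
      rw [Finset.sum_div]
      exact Finset.sum_congr rfl fun _ _ => by ring
    rw [this]
    field_simp
    ring
  exact HasFDerivAt.fun_sum fun k _ => (hs k).smul_const (b k)

/-- Key one-dimensional computation. -/
lemma interval_of_ratios {n : ℕ} (r : Fin (n + 1) → ℝ) (hneg : ∃ k, r k < 0) (hpos : ∃ k, 0 < r k) :
    ∃ k0 k1, r k0 < 0 ∧ 0 < r k1 ∧ (∀ k, r k0 ≤ r k) ∧ (∀ k, r k ≤ r k1) ∧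
      ∀ t : ℝ, (∀ k, 0 < 1 + t * r k) ↔ t ∈ Ioo (-(1 / r k1)) (1 / (- r k0)) := by
  obtain ⟨k0, h0⟩ := Finite.exists_min r
  obtain ⟨k1, h1⟩ := Finite.exists_max r
  obtain ⟨a, ha⟩ := hneg
  obtain ⟨c, hc⟩ := hpos
  have hk0 : r k0 < 0 := (h0 a).trans_lt ha
  have hk1 : 0 < r k1 := hc.trans_le (h1 c)
  refine ⟨k0, k1, hk0, hk1, h0, h1, fun t => ⟨fun h => ⟨?_, ?_⟩, fun h k => ?_⟩⟩
  · have := h k1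
    rw [neg_lt, lt_div_iff₀ hk1]; linarith
  · have := h k0
    rw [lt_div_iff₀ (by linarith)]; linarith
  · obtain ⟨h2, h3⟩ := h
    rw [lt_div_iff₀ (by linarith)] at h3
    rw [neg_lt, lt_div_iff₀ hk1] at h2
    rcases le_total 0 t with ht | ht
    · nlinarith [mul_le_mul_of_nonneg_left (h0 k) ht]
    · nlinarith [mul_le_mul_of_nonneg_left (h1 k) (neg_nonneg.2 ht)]

/-- The cell `{w | max w - min w < c}` (open version). -/
def Kop (d : ℕ) (c : ℝ) : Set (Euc d) :=
  {w | ∀ i j : Fin (d + 1), extL i w - extL j w < c}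

/-- The cell `{w | max w - min w ≤ c}` (closed version). -/
def Kcl (d : ℕ) (c : ℝ) : Set (Euc d) :=
  {w | ∀ i j : Fin (d + 1), extL i w - extL j w ≤ c}

lemma Phi_add_DPhi {d : ℕ} (b : AffineBasis (Fin (d + 1)) ℝ (Euc d)) (y w : Euc d) (t : ℝ) :
    Phi b y + t • DPhi b y w ∈ opS b ↔
      ∀ k, 0 < 1 + t * (extL k w - ∑ j, sm y j * extL j w) := by
  have h : ∀ k, b.coord k (Phi b y + t • DPhi b y w)
      = sm y k * (1 + t * (extL k w - ∑ j, sm y j * extL j w)) := by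
    intro k
    have : Phi b y + t • DPhi b y w = ∑ k, (sm y k + t * dw y w k) • b k := by
      rw [DPhi_apply, Phi, Finset.smul_sum, ← Finset.sum_add_distrib]
      exact Finset.sum_congr rfl fun _ _ => by rw [add_smul, mul_smul]
    rw [this, comb_coord b _ (by rw [Finset.sum_add_distrib, ← Finset.mul_sum, dw_sum, sm_sum]; simp)]
    simp only [dw]; ring
  simp only [opS, mem_ofPred_eq, h, mul_pos_iff_of_pos_left (sm_pos y _)]

lemma exists_signs {n : ℕ} (p r : Fin (n + 1) → ℝ) (hp : ∀ k, 0 < p k) (h : ∑ k, p k * r k = 0)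
    (hr : ∃ k, r k ≠ 0) : (∃ k, r k < 0) ∧ ∃ k, 0 < r k := by
  obtain ⟨k, hk⟩ := hr
  constructor
  · by_contra! hc
    have := (Finset.sum_eq_zero_iff_of_nonneg (fun i _ => mul_nonneg (hp i).le (hc i))).1 h k
      (Finset.mem_univ k)
    rcases mul_eq_zero.1 this with h | h
    · exact (hp k).ne' h
    · exact hk h
  · by_contra! hc
    have := (Finset.sum_eq_zero_iff_of_nonpos
      (fun i _ => mul_nonpos_of_nonneg_of_nonpos (hp i).le (hc i))).1 h k (Finset.mem_univ k)
    rcases mul_eq_zero.1 this with h | h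
    · exact (hp k).ne' h
    · exact hk h

lemma DPhi_eq_zero {d : ℕ} (b : AffineBasis (Fin (d + 1)) ℝ (Euc d)) (y w : Euc d)
    (h : DPhi b y w = 0) : w = 0 := by
  have h1 : ∀ t : ℝ, ∀ k, 0 < 1 + t * (extL k w - ∑ j, sm y j * extL j w) := by
    intro t
    rw [← Phi_add_DPhi b, h, smul_zero, add_zero]
    exact Phi_mem b y
  have h2 : ∀ k, extL k w - ∑ j, sm y j * extL j w = 0 := by
    intro k
    by_contra hk
    have := h1 (-1 / (extL k w - ∑ j, sm y j * extL j w)) k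
    rw [div_mul_cancel₀ _ hk] at this
    norm_num at this
  refine extL_ext fun k => ?_
  have h0 := h2 0
  rw [extL_zero] at h0
  have := h2 k
  rw [map_zero]
  linarith

lemma finsler_iff {d : ℕ} (b : AffineBasis (Fin (d + 1)) ℝ (Euc d)) (y w : Euc d) :
    finslerNorm (opS b) (Phi b y) (DPhi b y w) < 1 ↔ w ∈ Kop d 2 := by
  by_cases hw : w = 0
  · subst hw
    simp [finslerNorm, Kop]
  have hD : DPhi b y w ≠ 0 := fun h => hw (DPhi_eq_zero b y w h)
  set r : Fin (d + 1) → ℝ := fun k => extL k w - ∑ j, sm y j * extL j w with hr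
  have hsum : ∑ k, sm y k * r k = 0 := dw_sum y w
  have hne : ∃ k, r k ≠ 0 := by
    by_contra! hc
    apply hD
    rw [DPhi_apply]
    refine Finset.sum_eq_zero fun k _ => ?_
    have : dw y w k = sm y k * r k := rfl
    rw [this, hc k, mul_zero, zero_smul]
  obtain ⟨hn, hp⟩ := exists_signs _ r (sm_pos y) hsum hne
  obtain ⟨k0, k1, h0, h1, hmin, hmax, hI⟩ := interval_of_ratios r hn hp
  have e1 : {t : ℝ | 0 < t ∧ Phi b y + t • DPhi b y w ∈ opS b} = Ioo 0 (1 / (- r k0)) := by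
    ext t
    simp only [mem_ofPred_eq, Phi_add_DPhi]
    rw [hI t]
    have : 0 < 1 / r k1 := by positivity
    constructor
    · rintro ⟨ht, h⟩; exact ⟨ht, h.2⟩
    · rintro ⟨ht, h⟩; exact ⟨ht, by linarith, h⟩
  have e2 : {t : ℝ | 0 < t ∧ Phi b y - t • DPhi b y w ∈ opS b} = Ioo 0 (1 / r k1) := by
    ext t
    simp only [mem_ofPred_eq, sub_eq_add_neg, ← neg_smul]
    rw [Phi_add_DPhi]
    rw [hI (-t)]
    have : 0 < 1 / (- r k0) := by apply one_div_pos.2; linarith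
    constructor
    · rintro ⟨ht, h⟩; exact ⟨ht, by linarith [h.1]⟩
    · rintro ⟨ht, h⟩; exact ⟨ht, by linarith, by linarith⟩
  rw [finslerNorm, if_neg hD, e1, e2, csSup_Ioo (one_div_pos.2 (by linarith)),
    csSup_Ioo (one_div_pos.2 h1), one_div_one_div, one_div_one_div]
  have hdiff : ∀ i j, extL i w - extL j w = r i - r j := fun i j => by simp [hr]
  simp only [Kop, mem_ofPred_eq, hdiff]
  constructor
  · intro h i j
    linarith [hmin j, hmax i]
  · intro h
    linarith [h k1 k0]

lemma finslerUnitBall_eq {d : ℕ} (b : AffineBasis (Fin (d + 1)) ℝ (Euc d)) (y : Euc d) :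
    finslerUnitBall (opS b) (Phi b y) = DPhi b y '' Kop d 2 := by
  have hinj : Function.Injective (DPhi b y : Euc d →ₗ[ℝ] Euc d) := by
    rw [injective_iff_map_eq_zero]
    exact fun w hw => DPhi_eq_zero b y w hw
  have hsurj := LinearMap.surjective_of_injective hinj
  ext u
  obtain ⟨w, rfl⟩ := hsurj u
  constructor
  · intro h
    exact ⟨w, (finsler_iff b y w).1 h, rfl⟩
  · rintro ⟨w', hw', h⟩
    have : w' = w := hinj h
    subst this
    exact (finsler_iff b y w').2 hw'

lemma det_DPhi_ne {d : ℕ} (b : AffineBasis (Fin (d + 1)) ℝ (Euc d)) (y : Euc d) :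
    (DPhi b y).det ≠ 0 := by
  have hinj : Function.Injective (DPhi b y : Euc d →ₗ[ℝ] Euc d) := by
    rw [injective_iff_map_eq_zero]
    exact fun w hw => DPhi_eq_zero b y w hw
  have := (LinearMap.isUnit_iff_ker_eq_bot _).2 (LinearMap.ker_eq_bot.2 hinj)
  exact ((LinearMap.isUnit_iff_isUnit_det _).1 this).ne_zero

lemma Kop_isOpen (d : ℕ) (c : ℝ) : IsOpen (Kop d c) := by
  simp only [Kop, ofPred_forall]
  refine isOpen_iInter_of_finite fun i => isOpen_iInter_of_finite fun j => ?_
  exact isOpen_lt (by fun_prop) continuous_const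

lemma Kcl_isClosed (d : ℕ) (c : ℝ) : IsClosed (Kcl d c) := by
  simp only [Kcl, ofPred_forall]
  refine isClosed_iInter fun i => isClosed_iInter fun j => ?_
  exact isClosed_le (by fun_prop) continuous_const

lemma box_finite (d : ℕ) (M : ℝ) : volume {w : Euc d | ∀ i, |w i| ≤ M} ≠ ⊤ := by
  have h : {w : Euc d | ∀ i, |w i| ≤ M} ⊆ Metric.closedBall 0 (√(∑ _i : Fin d, M ^ 2)) := by
    intro w hw
    rw [mem_closedBall_zero_iff, EuclideanSpace.norm_eq]
    apply Real.sqrt_le_sqrt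
    refine Finset.sum_le_sum fun i _ => ?_
    have := hw i
    rw [Real.norm_eq_abs]
    gcongr
  exact ((measure_mono h).trans_lt measure_closedBall_lt_top).ne

lemma Kcl_finite (d : ℕ) (c : ℝ) : volume (Kcl d c) ≠ ⊤ := by
  refine ne_top_of_le_ne_top (box_finite d c) (measure_mono fun w hw i => ?_)
  have h1 := hw i.succ 0
  have h2 := hw 0 i.succ
  rw [extL_zero, extL_succ] at h1 h2
  exact abs_le.2 ⟨by linarith, by linarith⟩

lemma Kop_subset (d : ℕ) (c : ℝ) : Kop d c ⊆ Kcl d c := fun _ hw i j => (hw i j).le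

lemma Kop_pos (d : ℕ) : volume (Kop d 2) ≠ 0 :=
  ((Kop_isOpen d 2).measure_pos volume ⟨0, fun i j => by simp⟩).ne'

/-- In logarithmic coordinates, the Busemann volume is a multiple of Lebesgue measure. -/
lemma busemannVol_image {d : ℕ} (b : AffineBasis (Fin (d + 1)) ℝ (Euc d)) (B : Set (Euc d))
    (hB : MeasurableSet B) :
    busemannVol (opS b) (Phi b '' B) =
      volume (Metric.ball (0 : Euc d) 1) / volume (Kop d 2) * volume B := by
  rw [busemannVol, lintegral_image_eq_lintegral_abs_det_fderiv_mul volume hB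
    (fun x _ => (hasFDerivAt_Phi b x).hasFDerivWithinAt) (Phi_inj b).injOn]
  rw [← setLIntegral_const]
  refine setLIntegral_congr_fun hB fun y _ => ?_
  rw [finslerUnitBall_eq, Measure.addHaar_image_continuousLinearMap]
  have h1 : ENNReal.ofReal |(DPhi b y).det| ≠ 0 := by
    simpa using det_DPhi_ne b y
  change _ * (_ / (ENNReal.ofReal |(DPhi b y).det| * _)) = _
  rw [← mul_div_assoc]
  exact ENNReal.mul_div_mul_left _ _ h1 ENNReal.ofReal_ne_top

lemma hilbertBall_eq {d : ℕ} (b : AffineBasis (Fin (d + 1)) ℝ (Euc d)) (y : Euc d) {R : ℝ}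
    (hR : 0 ≤ R) :
    hilbertBall (opS b) (Phi b y) R = Phi b '' ((fun x => x - y) ⁻¹' Kcl d (2 * R)) := by
  have key : ∀ x, hilbertDist (opS b) (Phi b y) (Phi b x) ≤ R ↔ x - y ∈ Kcl d (2 * R) := by
    intro x
    by_cases hxy : Phi b y = Phi b x
    · have : y = x := Phi_inj b hxy
      subst this
      simp [hilbertDist, Kcl, hR]
    set r : Fin (d + 1) → ℝ := fun k => sm x k / sm y k - 1 with hr
    have hmem : ∀ t : ℝ, Phi b y + t • (Phi b x - Phi b y) ∈ opS b ↔ ∀ k, 0 < 1 + t * r k := by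
      intro t
      have h : ∀ k, b.coord k (Phi b y + t • (Phi b x - Phi b y)) = sm y k * (1 + t * r k) := by
        intro k
        have : Phi b y + t • (Phi b x - Phi b y) = AffineMap.lineMap (Phi b y) (Phi b x) t := by
          rw [AffineMap.lineMap_apply, vsub_eq_sub, vadd_eq_add, add_comm]
        rw [this, AffineMap.apply_lineMap, AffineMap.lineMap_apply, coord_Phi, coord_Phi]
        have := (sm_pos y k).ne'
        simp only [hr, vsub_eq_sub, vadd_eq_add, smul_eq_mul]
        field_simp
        ring
      simp only [opS, mem_ofPred_eq, h, mul_pos_iff_of_pos_left (sm_pos y _)]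
    have hsum : ∑ k, sm y k * r k = 0 := by
      have : ∀ k, sm y k * r k = sm x k - sm y k := fun k => by
        have := (sm_pos y k).ne'
        simp only [hr]; field_simp
      simp only [this, Finset.sum_sub_distrib, sm_sum, sub_self]
    have hne : ∃ k, r k ≠ 0 := by
      by_contra! hc
      apply hxy
      simp only [Phi]
      refine Finset.sum_congr rfl fun k _ => ?_
      have h1 := hc k
      have := (sm_pos y k).ne'
      simp only [hr, sub_eq_zero] at h1
      rw [div_eq_one_iff_eq this] at h1
      rw [h1]
    obtain ⟨hn, hp⟩ := exists_signs _ r (sm_pos y) hsum hne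
    obtain ⟨k0, k1, h0, h1, hmin, hmax, hI⟩ := interval_of_ratios r hn hp
    have e1 : {t : ℝ | Phi b y + t • (Phi b x - Phi b y) ∈ opS b}
        = Ioo (-(1 / r k1)) (1 / (- r k0)) := by
      ext t
      rw [mem_ofPred_eq, hmem, hI]
    have hp0 : 0 < 1 / (- r k0) := one_div_pos.2 (by linarith)
    have hp1 : 0 < 1 / r k1 := one_div_pos.2 h1
    have hr1 : ∀ k, 0 < 1 + r k := fun k => by
      have := div_pos (sm_pos x k) (sm_pos y k)
      simp only [hr]; linarith
    have e2 : ((1 - -(1 / r k1)) / - -(1 / r k1)) * (1 / (- r k0) / (1 / (- r k0) - 1))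
        = (1 + r k1) / (1 + r k0) := by
      have a1 := (hr1 k0).ne'
      have a3 := h0.ne
      have a4 := h1.ne'
      have a5 : - r k0 ≠ 0 := neg_ne_zero.2 a3
      have a2 : (1 / (- r k0) - 1) = (1 + r k0) / (- r k0) := by field_simp; ring
      rw [a2]
      field_simp
      ring
    rw [hilbertDist, if_neg hxy, e1, csSup_Ioo (by linarith), csInf_Ioo (by linarith), e2,
      Real.log_div (hr1 k1).ne' (hr1 k0).ne']
    have hlog : ∀ k, Real.log (1 + r k) = extL k x - extL k y - (Real.log (smZ x) - Real.log (smZ y)) := by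
      intro k
      have : 1 + r k = sm x k / sm y k := by simp [hr]
      rw [this, Real.log_div (sm_pos x k).ne' (sm_pos y k).ne', sm, sm,
        Real.log_div (Real.exp_pos _).ne' (smZ_pos _).ne',
        Real.log_div (Real.exp_pos _).ne' (smZ_pos _).ne', Real.log_exp, Real.log_exp]
      ring
    have hdiff : ∀ i j, extL i (x - y) - extL j (x - y)
        = Real.log (1 + r i) - Real.log (1 + r j) := fun i j => by
      rw [hlog, hlog, map_sub, map_sub]; ring
    simp only [Kcl, mem_ofPred_eq, hdiff]
    constructor
    · intro h i j
      have b1 := Real.log_le_log (hr1 k0) (add_le_add_right (hmin j) 1)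
      have b2 := Real.log_le_log (hr1 i) (add_le_add_right (hmax i) 1)
      linarith
    · intro h
      linarith [h k1 k0]
  ext q
  constructor
  · rintro ⟨hq, hq'⟩
    refine ⟨Psi b q, ?_, Phi_Psi b hq⟩
    rw [mem_preimage, ← key, Phi_Psi b hq]
    exact hq'
  · rintro ⟨x, hx, rfl⟩
    exact ⟨Phi_mem b x, (key x).2 hx⟩

/-! ### Symmetry: the order cells -/

lemma null_level {d : ℕ} (l : Euc d →L[ℝ] ℝ) (hl : ∃ y, l y ≠ 0) (c : ℝ) :
    volume {y : Euc d | l y = c} = 0 := by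
  rcases Set.eq_empty_or_nonempty {y : Euc d | l y = c} with h | ⟨y0, hy0⟩
  · rw [h, measure_empty]
  · have hy0 : l y0 = c := hy0
    have h : {y : Euc d | l y = c} = (fun y => y - y0) ⁻¹' (LinearMap.ker (l : Euc d →ₗ[ℝ] ℝ) : Set (Euc d)) := by
      ext y
      simp [sub_eq_zero, hy0]
    rw [h]
    simp only [sub_eq_add_neg]
    rw [measure_preimage_add_right]
    apply Measure.addHaar_submodule
    intro ht
    obtain ⟨y, hy⟩ := hl
    have : y ∈ LinearMap.ker (l : Euc d →ₗ[ℝ] ℝ) := by rw [ht]; trivial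
    exact hy this

lemma null_eq {d : ℕ} (i j : Fin (d + 1)) (hij : i ≠ j) :
    volume {y : Euc d | extL i y = extL j y} = 0 := by
  have h := null_level (extL i - extL j : Euc d →L[ℝ] ℝ) ?_ 0
  · convert h using 3
    ext y
    simp [sub_eq_zero]
  · refine ⟨WithLp.toLp 2 (fun i : Fin d => ((i : ℕ) : ℝ) + 1), ?_⟩
    have : ∀ k : Fin (d + 1), extL k (WithLp.toLp 2 (fun i : Fin d => ((i : ℕ) : ℝ) + 1) : Euc d)
        = ((k : ℕ) : ℝ) := by
      intro k
      refine Fin.cases ?_ (fun i => ?_) k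
      · simp [extL_zero]
      · simp [extL_succ]
    rw [sub_apply, this, this, sub_ne_zero]
    exact fun h => hij (Fin.ext (by exact_mod_cast h))

lemma null_const {d : ℕ} (k : Fin (d + 1)) {c : ℝ} (hc : c ≠ 0) :
    volume {y : Euc d | extL k y = c} = 0 := by
  refine Fin.cases ?_ (fun i => ?_) k
  · simp [extL_zero, hc.symm]
  · refine null_level _ ⟨WithLp.toLp 2 (fun _ : Fin d => 1), ?_⟩ c
    simp [extL_succ]

lemma ae_inj (d : ℕ) : ∀ᵐ y : Euc d, Function.Injective (fun k : Fin (d + 1) => extL k y) := by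
  have : ∀ᵐ y : Euc d, ∀ i j : Fin (d + 1), i ≠ j → extL i y ≠ extL j y := by
    rw [ae_all_iff]; intro i
    rw [ae_all_iff]; intro j
    by_cases hij : i = j
    · simp [hij]
    · have := null_eq i j hij
      rw [ae_iff]
      simpa [hij] using this
  filter_upwards [this] with y hy i j h
  by_contra hc
  exact hy i j hc h

/-- The order cell. -/
def Tcell (d : ℕ) : Set (Euc d) :=
  {y | Antitone (fun k : Fin (d + 1) => extL k y) ∧ ∀ k : Fin (d + 1), -2 ≤ extL k y}

lemma Tcell_isClosed (d : ℕ) : IsClosed (Tcell d) := by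
  have : Tcell d = (⋂ (i : Fin (d + 1)) (j : Fin (d + 1)) (_ : i ≤ j), {y | extL j y ≤ extL i y}) ∩
      ⋂ k : Fin (d + 1), {y | -2 ≤ extL k y} := by
    ext y
    simp [Tcell, Antitone]
  rw [this]
  refine IsClosed.inter ?_ ?_
  · refine isClosed_iInter fun i => isClosed_iInter fun j => isClosed_iInter fun _ => ?_
    exact isClosed_le (by fun_prop) (by fun_prop)
  · refine isClosed_iInter fun i => ?_
    exact isClosed_le (by fun_prop) (by fun_prop)

/-- The permutation action in logarithmic coordinates. -/
def permL {d : ℕ} (σ : Equiv.Perm (Fin (d + 1))) : Euc d →ₗ[ℝ] Euc d where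
  toFun y := WithLp.toLp 2 (fun i : Fin d => extL (σ i.succ) y - extL (σ 0) y)
  map_add' x y := by ext i; simp; ring
  map_smul' c y := by ext i; simp; ring

lemma extL_permL {d : ℕ} (σ : Equiv.Perm (Fin (d + 1))) (y : Euc d) (k : Fin (d + 1)) :
    extL k (permL σ y) = extL (σ k) y - extL (σ 0) y := by
  refine Fin.cases ?_ (fun i => ?_) k
  · simp [extL_zero]
  · rw [extL_succ]; rfl

lemma permL_preimage {d : ℕ} (σ : Equiv.Perm (Fin (d + 1))) (s : Set (Euc d)) :
    volume (permL σ ⁻¹' s) = volume s := by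
  have hinj : Function.Injective (permL σ) := by
    rw [injective_iff_map_eq_zero]
    intro y hy
    have h : ∀ k, extL (σ k) y = extL (σ 0) y := fun k => by
      have := extL_permL σ y k
      rw [hy, map_zero] at this
      linarith
    have h' : ∀ k, extL k y = extL (σ 0) y := fun k => by
      have := h (σ.symm k); rwa [σ.apply_symm_apply] at this
    refine extL_ext fun k => ?_
    rw [map_zero, h' k, ← h' 0, extL_zero]
  have hdet : LinearMap.det (permL σ) ≠ 0 :=
    ((LinearMap.isUnit_iff_isUnit_det _).1
      ((LinearMap.isUnit_iff_ker_eq_bot _).2 (LinearMap.ker_eq_bot.2 hinj))).ne_zero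
  have hK : permL σ ⁻¹' Kop d 2 = Kop d 2 := by
    ext y
    simp only [mem_preimage, Kop, mem_ofPred_eq, extL_permL]
    constructor
    · intro h i j
      have := h (σ.symm i) (σ.symm j)
      rw [σ.apply_symm_apply, σ.apply_symm_apply] at this
      linarith
    · intro h i j
      linarith [h (σ i) (σ j)]
  have h1 := Measure.addHaar_preimage_linearMap volume hdet (Kop d 2)
  rw [hK] at h1
  have hfin : volume (Kop d 2) ≠ ⊤ := ne_top_of_le_ne_top (Kcl_finite d 2) (measure_mono (Kop_subset d 2))
  have h2 : ENNReal.ofReal |(LinearMap.det (permL σ))⁻¹| = 1 := by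
    have : ENNReal.ofReal |(LinearMap.det (permL σ))⁻¹| * volume (Kop d 2) = 1 * volume (Kop d 2) := by
      rw [← h1, one_mul]
    exact (ENNReal.mul_left_inj (Kop_pos d) hfin).1 this
  rw [Measure.addHaar_preimage_linearMap volume hdet, h2, one_mul]

lemma mem_permL_Tcell {d : ℕ} (σ : Equiv.Perm (Fin (d + 1))) (y : Euc d) :
    y ∈ permL σ ⁻¹' Tcell d ↔ Antitone (fun k => extL (σ k) y) ∧
      ∀ k, -2 ≤ extL (σ k) y - extL (σ 0) y := by
  simp only [mem_preimage, Tcell, mem_ofPred_eq, extL_permL, Antitone, sub_le_sub_iff_right]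

lemma Kcl_eq_iUnion (d : ℕ) : Kcl d 2 = ⋃ σ : Equiv.Perm (Fin (d + 1)), permL σ ⁻¹' Tcell d := by
  ext y
  simp only [mem_iUnion, mem_permL_Tcell]
  constructor
  · intro h
    refine ⟨Tuple.sort (fun k : Fin (d + 1) => - extL k y), ?_, fun k => ?_⟩
    · intro i j hij
      have := Tuple.monotone_sort (fun k : Fin (d + 1) => - extL k y) hij
      simp only [Function.comp] at this
      simp only
      linarith
    · linarith [h (Tuple.sort (fun k : Fin (d + 1) => - extL k y) 0)
        (Tuple.sort (fun k : Fin (d + 1) => - extL k y) k)]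
  · rintro ⟨σ, ha, hb⟩ i j
    have h1 := hb (σ.symm j)
    have h2 := ha (Fin.zero_le (σ.symm i))
    simp only [σ.apply_symm_apply] at h1 h2
    linarith

lemma volume_Kcl (d : ℕ) : volume (Kcl d 2) = ((Nat.factorial (d + 1) : ℕ) : ℝ≥0∞) * volume (Tcell d) := by
  rw [Kcl_eq_iUnion, measure_iUnion₀]
  · simp only [permL_preimage]
    rw [tsum_fintype, Finset.sum_const, Finset.card_univ, Fintype.card_perm, Fintype.card_fin,
      nsmul_eq_mul]
  · intro σ τ hst
    refine measure_mono_null ?_ (ae_iff.1 (ae_inj d))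
    rintro y ⟨h1, h2⟩ hy
    rw [mem_permL_Tcell] at h1 h2
    apply hst
    have := Tuple.unique_monotone (f := fun k : Fin (d + 1) => - extL k y) (σ := σ) (τ := τ)
      (fun i j hij => neg_le_neg (h1.1 hij)) (fun i j hij => neg_le_neg (h2.1 hij))
    ext k
    have h3 := congrFun this k
    simp only [Function.comp, neg_inj] at h3
    rw [hy h3]
  · intro σ
    exact ((Tcell_isClosed d).preimage (LinearMap.continuous_of_finiteDimensional _)).measurableSet.nullMeasurableSet

/-! ### The limit -/

lemma coord_change {d : ℕ} (b bS : AffineBasis (Fin (d + 1)) ℝ (Euc d)) (k : Fin (d + 1))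
    (q : Euc d) : b.coord k q = ∑ j, bS.coord j q * b.coord k (bS j) := by
  have h := bS.affineCombination_coord_eq_self q
  have hs := bS.sum_coord_apply_eq_one q
  conv_lhs => rw [← h]
  rw [Finset.map_affineCombination _ _ _ hs, Finset.affineCombination_eq_linear_combination _ _ _ hs]
  rfl

lemma exists_ratio_bound {d : ℕ} (b bS : AffineBasis (Fin (d + 1)) ℝ (Euc d))
    (hpos : ∀ j k, k ≤ j → 0 < b.coord k (bS j)) (hzero : ∀ j k, j < k → b.coord k (bS j) = 0) :
    ∃ C : ℝ, 0 < C ∧ ∀ q, (∀ j, 0 ≤ bS.coord j q) → ∀ i k, i ≤ k →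
      b.coord k q ≤ C * b.coord i q := by
  have hnn : ∀ j k, 0 ≤ b.coord k (bS j) := fun j k => by
    rcases le_or_gt k j with h | h
    · exact (hpos j k h).le
    · exact (hzero j k h).ge
  have hterm : ∀ j i k, 0 ≤ b.coord k (bS j) / b.coord i (bS j) :=
    fun j i k => div_nonneg (hnn j k) (hnn j i)
  set C : ℝ := 1 + ∑ j, ∑ i, ∑ k, b.coord k (bS j) / b.coord i (bS j) with hC
  have hCb : ∀ j i k, b.coord k (bS j) / b.coord i (bS j) ≤ C := by
    intro j i k
    have h1 := Finset.single_le_sum (f := fun k => b.coord k (bS j) / b.coord i (bS j))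
      (fun k _ => hterm j i k) (Finset.mem_univ k)
    have h2 := Finset.single_le_sum (f := fun i => ∑ k, b.coord k (bS j) / b.coord i (bS j))
      (fun i _ => Finset.sum_nonneg fun k _ => hterm j i k) (Finset.mem_univ i)
    have h3 := Finset.single_le_sum (f := fun j => ∑ i, ∑ k, b.coord k (bS j) / b.coord i (bS j))
      (fun j _ => Finset.sum_nonneg fun i _ => Finset.sum_nonneg fun k _ => hterm j i k)
      (Finset.mem_univ j)
    linarith
  have hC0 : 0 < C := by
    have : 0 ≤ ∑ j, ∑ i, ∑ k, b.coord k (bS j) / b.coord i (bS j) :=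
      Finset.sum_nonneg fun j _ => Finset.sum_nonneg fun i _ => Finset.sum_nonneg fun k _ => hterm j i k
    linarith
  refine ⟨C, hC0, fun q hq i k hik => ?_⟩
  rw [coord_change b bS k q, coord_change b bS i q, Finset.mul_sum]
  refine Finset.sum_le_sum fun j _ => ?_
  have : b.coord k (bS j) ≤ C * b.coord i (bS j) := by
    rcases le_or_gt i j with h | h
    · exact (div_le_iff₀ (hpos j i h)).1 (hCb j i k)
    · rw [hzero j i h, hzero j k (h.trans_le hik), mul_zero]
  nlinarith [mul_le_mul_of_nonneg_left this (hq j)]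

/-- The region of interest in logarithmic coordinates. -/
def Areg {d : ℕ} (b bS : AffineBasis (Fin (d + 1)) ℝ (Euc d)) (ζ : Fin (d + 1) → ℝ) (R : ℝ) :
    Set (Euc d) :=
  {y | (∀ k, Real.exp (-2 * R) * ζ k < sm y k) ∧ ∀ j, 0 ≤ bS.coord j (Phi b y)}

lemma continuous_Phi {d : ℕ} (b : AffineBasis (Fin (d + 1)) ℝ (Euc d)) : Continuous (Phi b) :=
  continuous_iff_continuousAt.2 fun y => (hasFDerivAt_Phi b y).continuousAt

lemma continuous_sm {d : ℕ} (b : AffineBasis (Fin (d + 1)) ℝ (Euc d)) (k : Fin (d + 1)) :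
    Continuous fun y : Euc d => sm y k := by
  have : (fun y : Euc d => sm y k) = fun y => b.coord k (Phi b y) := by
    ext y; rw [coord_Phi]
  rw [this]
  exact (b.coord k).continuous_of_finiteDimensional.comp (continuous_Phi b)

lemma Areg_meas {d : ℕ} (b bS : AffineBasis (Fin (d + 1)) ℝ (Euc d)) (ζ : Fin (d + 1) → ℝ) (R : ℝ) :
    MeasurableSet (Areg b bS ζ R) := by
  have : Areg b bS ζ R = (⋂ k, {y | Real.exp (-2 * R) * ζ k < sm y k}) ∩
      ⋂ j, {y | 0 ≤ bS.coord j (Phi b y)} := by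
    ext y; simp [Areg]
  rw [this]
  refine MeasurableSet.inter (MeasurableSet.iInter fun k => ?_) (MeasurableSet.iInter fun j => ?_)
  · exact (isOpen_lt continuous_const (continuous_sm b k)).measurableSet
  · exact (isClosed_le continuous_const
      ((bS.coord j).continuous_of_finiteDimensional.comp (continuous_Phi b))).measurableSet

lemma sm_div_sm {d : ℕ} (y : Euc d) (i k : Fin (d + 1)) :
    sm y k / sm y i = Real.exp (extL k y - extL i y) := by
  have := (smZ_pos y).ne'
  rw [sm, sm, Real.exp_sub]
  field_simp

/-- If the logarithmic direction is strictly decreasing, the new coordinates become positive. -/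
lemma tendsto_coord {d : ℕ} (b bS : AffineBasis (Fin (d + 1)) ℝ (Euc d))
    (hpos : ∀ j k, k ≤ j → 0 < b.coord k (bS j)) (hzero : ∀ j k, j < k → b.coord k (bS j) = 0)
    (y : Euc d) (hy : StrictAnti (fun k : Fin (d + 1) => extL k y)) (i : Fin (d + 1)) :
    Tendsto (fun R : ℝ => bS.coord i (Phi b (R • y)) / sm (R • y) i) atTop
      (𝓝 (1 / b.coord i (bS i))) := by
  induction i using WellFoundedGT.induction with
  | ind i ih =>
  have hii := hpos i i le_rfl
  have hexp : ∀ R : ℝ, bS.coord i (Phi b (R • y)) / sm (R • y) i =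
      (1 - ∑ j ∈ Finset.Ioi i, (bS.coord j (Phi b (R • y)) / sm (R • y) j) *
        (sm (R • y) j / sm (R • y) i) * b.coord i (bS j)) / b.coord i (bS i) := by
    intro R
    have h1 := coord_change b bS i (Phi b (R • y))
    rw [coord_Phi] at h1
    have h2 : ∑ j, bS.coord j (Phi b (R • y)) * b.coord i (bS j)
        = bS.coord i (Phi b (R • y)) * b.coord i (bS i) +
          ∑ j ∈ Finset.Ioi i, bS.coord j (Phi b (R • y)) * b.coord i (bS j) := by
      rw [← Finset.sum_subset (Finset.subset_univ (Finset.Ici i)), ← Finset.Ioi_insert,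
        Finset.sum_insert (by simp)]
      intro j _ hj
      rw [hzero j i (by simpa using hj), mul_zero]
    have hs := (sm_pos (R • y) i).ne'
    have h3 : ∑ j ∈ Finset.Ioi i, (bS.coord j (Phi b (R • y)) / sm (R • y) j) *
        (sm (R • y) j / sm (R • y) i) * b.coord i (bS j)
        = (∑ j ∈ Finset.Ioi i, bS.coord j (Phi b (R • y)) * b.coord i (bS j)) / sm (R • y) i := by
      rw [Finset.sum_div]
      refine Finset.sum_congr rfl fun j _ => ?_
      have := (sm_pos (R • y) j).ne'
      field_simp
    rw [h3, eq_div_iff hii.ne']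
    field_simp
    linarith
  simp only [hexp]
  have hlim : Tendsto (fun R : ℝ => ∑ j ∈ Finset.Ioi i,
      (bS.coord j (Phi b (R • y)) / sm (R • y) j) *
        (sm (R • y) j / sm (R • y) i) * b.coord i (bS j)) atTop (𝓝 0) := by
    rw [← Finset.sum_const_zero (s := Finset.Ioi i)]
    refine tendsto_finsetSum _ fun j hj => ?_
    have hj : i < j := by simpa using hj
    have h1 : Tendsto (fun R : ℝ => sm (R • y) j / sm (R • y) i) atTop (𝓝 0) := by
      simp only [sm_div_sm, map_smul, smul_eq_mul, ← mul_sub]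
      refine Real.tendsto_exp_atBot.comp ?_
      exact tendsto_id.atTop_mul_const_of_neg (sub_neg.2 (hy hj))
    have := ((ih j hj).mul h1).mul_const (b.coord i (bS j))
    simpa using this
  have := (hlim.const_sub 1).div_const (b.coord i (bS i))
  simpa using this

lemma sm_le {d : ℕ} (y : Euc d) (k : Fin (d + 1)) : sm y k ≤ Real.exp (extL k y) :=
  div_le_self (Real.exp_pos _).le (one_le_smZ y)

lemma tendsto_volume_Areg {d : ℕ} (b bS : AffineBasis (Fin (d + 1)) ℝ (Euc d))
    (hpos : ∀ j k, k ≤ j → 0 < b.coord k (bS j)) (hzero : ∀ j k, j < k → b.coord k (bS j) = 0)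
    (ζ : Fin (d + 1) → ℝ) (hζ : ∀ k, 0 < ζ k) :
    Tendsto (fun R : ℝ => volume ((fun y : Euc d => R • y) ⁻¹' Areg b bS ζ R)) atTop
      (𝓝 (volume (Tcell d))) := by
  obtain ⟨C, hC0, hC⟩ := exists_ratio_bound b bS hpos hzero
  have hC' : ∀ x, (∀ j, 0 ≤ bS.coord j (Phi b x)) → ∀ i k, i ≤ k →
      extL k x - extL i x ≤ Real.log C := by
    intro x hx i k hik
    have := hC _ hx i k hik
    rw [coord_Phi, coord_Phi, ← div_le_iff₀ (sm_pos x i), sm_div_sm] at this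
    exact (Real.le_log_iff_exp_le hC0).2 this
  have hlow : ∀ R x, (∀ k, Real.exp (-2 * R) * ζ k < sm x k) → ∀ k,
      -2 * R + Real.log (ζ k) ≤ extL k x := by
    intro R x hx k
    have := (hx k).le.trans (sm_le x k)
    rw [← Real.exp_le_exp, Real.exp_add, Real.exp_log (hζ k)]
    exact this
  set M : ℝ := 2 + |Real.log C| + ∑ k, |Real.log (ζ k)| with hM
  have hMk : ∀ k, |Real.log (ζ k)| ≤ ∑ k, |Real.log (ζ k)| := fun k =>
    Finset.single_le_sum (f := fun k => |Real.log (ζ k)|) (fun k _ => abs_nonneg _)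
      (Finset.mem_univ k)
  have hbox : MeasurableSet {w : Euc d | ∀ i, |w i| ≤ M} := by
    have : {w : Euc d | ∀ i, |w i| ≤ M} = ⋂ i, {w : Euc d | |w i| ≤ M} := by ext; simp
    rw [this]
    refine MeasurableSet.iInter fun i => (isClosed_le ?_ continuous_const).measurableSet
    fun_prop
  refine tendsto_measure_of_ae_tendsto_indicator atTop (Tcell_isClosed d).measurableSet
    (fun R => (Areg_meas b bS ζ R).preimage (by fun_prop)) hbox (box_finite d M) ?_ ?_
  · filter_upwards [eventually_ge_atTop (1 : ℝ)] with R hR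
    intro y hy i
    obtain ⟨h1, h2⟩ := hy
    have a1 := hlow R _ h1 i.succ
    have a2 := hC' _ h2 0 i.succ (Fin.zero_le _)
    rw [extL_zero] at a2
    rw [map_smul, extL_succ, smul_eq_mul] at a1 a2
    have hk := hMk i.succ
    have hn := neg_abs_le (Real.log (ζ i.succ))
    have hlc := le_abs_self (Real.log C)
    have h0 := abs_nonneg (Real.log (ζ i.succ))
    have h0' := abs_nonneg (Real.log C)
    have hS0 : 0 ≤ ∑ k, |Real.log (ζ k)| := h0.trans hk
    rw [abs_le]
    constructor
    · have : R * (-M) ≤ R * y i := by nlinarith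
      exact le_of_mul_le_mul_left this (by linarith)
    · have : R * y i ≤ R * M := by nlinarith
      exact le_of_mul_le_mul_left this (by linarith)
  · have hae : ∀ᵐ y : Euc d, ∀ k : Fin (d + 1), extL k y ≠ -2 := by
      rw [ae_all_iff]
      intro k
      rw [ae_iff]
      simpa using null_const k (c := -2) (by norm_num)
    filter_upwards [ae_inj d, hae] with y hinj hne
    by_cases hyT : y ∈ Tcell d
    · have hanti : StrictAnti (fun k : Fin (d + 1) => extL k y) := hyT.1.strictAnti_of_injective hinj
      have e1 : ∀ᶠ R : ℝ in atTop, ∀ j, 0 ≤ bS.coord j (Phi b (R • y)) := by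
        rw [eventually_all]
        intro j
        have := (tendsto_coord b bS hpos hzero y hanti j).eventually
          (lt_mem_nhds (one_div_pos.2 (hpos j j le_rfl)))
        filter_upwards [this] with R hR
        have := mul_pos hR (sm_pos (R • y) j)
        rw [div_mul_cancel₀ _ (sm_pos (R • y) j).ne'] at this
        exact this.le
      have e2 : ∀ᶠ R : ℝ in atTop, ∀ k, Real.exp (-2 * R) * ζ k < sm (R • y) k := by
        rw [eventually_all]
        intro k
        have hk : 0 < extL k y + 2 := by
          have := lt_of_le_of_ne (hyT.2 k) (hne k).symm
          linarith
        have ht : Tendsto (fun R : ℝ => Real.exp (R * (extL k y + 2))) atTop atTop :=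
          Real.tendsto_exp_atTop.comp (tendsto_id.atTop_mul_const hk)
        filter_upwards [ht.eventually_gt_atTop (ζ k * (d + 1)), eventually_ge_atTop (0 : ℝ)] with R hR hR0
        have hZ : smZ (R • y) ≤ d + 1 := by
          have : ∀ j ∈ (Finset.univ : Finset (Fin (d + 1))), Real.exp (extL j (R • y)) ≤ 1 := by
            intro j _
            rw [Real.exp_le_one_iff, map_smul, smul_eq_mul]
            have := hyT.1 (Fin.zero_le j)
            simp only [extL_zero] at this
            exact mul_nonpos_of_nonneg_of_nonpos hR0 this
          have := Finset.sum_le_sum this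
          simpa [smZ] using this
        rw [sm, lt_div_iff₀ (smZ_pos _)]
        have hE : Real.exp (extL k (R • y)) = Real.exp (-2 * R) * Real.exp (R * (extL k y + 2)) := by
          rw [← Real.exp_add, map_smul, smul_eq_mul]; ring_nf
        rw [hE, mul_assoc]
        refine mul_lt_mul_of_pos_left (lt_of_le_of_lt ?_ hR) (Real.exp_pos _)
        exact mul_le_mul_of_nonneg_left hZ (hζ k).le
      filter_upwards [e1, e2] with R h1 h2
      exact ⟨fun _ => hyT, fun _ => ⟨h2, h1⟩⟩
    · have : ∀ᶠ R : ℝ in atTop, R • y ∉ Areg b bS ζ R := by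
        by_cases hA : Antitone (fun k : Fin (d + 1) => extL k y)
        · have : ∃ k : Fin (d + 1), extL k y < -2 := by
            by_contra! hc
            exact hyT ⟨hA, hc⟩
          obtain ⟨k, hk⟩ := this
          have ht : Tendsto (fun R : ℝ => R * (-2 - extL k y)) atTop atTop :=
            tendsto_id.atTop_mul_const (by linarith)
          filter_upwards [ht.eventually_gt_atTop (-Real.log (ζ k))] with R hR hmem
          have := hlow R _ hmem.1 k
          rw [map_smul, smul_eq_mul] at this
          linarith
        · have : ∃ i k : Fin (d + 1), i ≤ k ∧ extL i y < extL k y := by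
            by_contra! hc
            exact hA fun i k h => hc i k h
          obtain ⟨i, k, hik, hlt⟩ := this
          have ht : Tendsto (fun R : ℝ => R * (extL k y - extL i y)) atTop atTop :=
            tendsto_id.atTop_mul_const (by linarith)
          filter_upwards [ht.eventually_gt_atTop (Real.log C)] with R hR hmem
          have := hC' _ hmem.2 i k hik
          rw [map_smul, map_smul, smul_eq_mul, smul_eq_mul] at this
          linarith
      filter_upwards [this] with R hR
      exact ⟨fun h => absurd h hR, fun h => absurd h hyT⟩

/-! ### Faces of simplices and flags -/

lemma hull_eq {d : ℕ} (b : AffineBasis (Fin (d + 1)) ℝ (Euc d)) :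
    convexHull ℝ (Set.range b) = {x | ∀ i, 0 ≤ b.coord i x} := b.convexHull_eq_nonneg_coord

lemma coord_add_smul {d : ℕ} (b : AffineBasis (Fin (d + 1)) ℝ (Euc d)) (k : Fin (d + 1))
    (x y : Euc d) (t : ℝ) :
    b.coord k (x + t • (y - x)) = b.coord k x + t * (b.coord k y - b.coord k x) := by
  have : x + t • (y - x) = AffineMap.lineMap x y t := by
    rw [AffineMap.lineMap_apply, vsub_eq_sub, vadd_eq_add, add_comm]
  rw [this, AffineMap.apply_lineMap, AffineMap.lineMap_apply, vsub_eq_sub, vadd_eq_add, smul_eq_mul,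
    add_comm]

lemma face_vertex {d : ℕ} (b : AffineBasis (Fin (d + 1)) ℝ (Euc d)) {F : Set (Euc d)}
    (hF : IsFace (convexHull ℝ (Set.range b)) F) {x : Euc d} (hx : x ∈ F) {k : Fin (d + 1)}
    (hk : 0 < b.coord k x) : b k ∈ F := by
  obtain ⟨-, -, -, hext⟩ := hF
  have hxS := hext.subset hx
  rw [hull_eq] at hxS
  set c := b.coord k x with hc
  have hy : x + (-c) • (b k - x) ∈ convexHull ℝ (Set.range b) := by
    rw [hull_eq]
    intro j
    rw [coord_add_smul]
    have hj := hxS j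
    by_cases hjk : j = k
    · subst hjk
      rw [b.coord_apply_eq, ← hc]
      nlinarith
    · rw [b.coord_apply_ne hjk]
      nlinarith
  refine hext.left_mem_of_mem_openSegment (subset_convexHull ℝ _ (mem_range_self k)) hy hx ?_
  refine ⟨c / (1 + c), 1 / (1 + c), by positivity, by positivity, by field_simp; ring, ?_⟩
  have h1 : (1 + c) ≠ 0 := by positivity
  have : x = (1 + c)⁻¹ • ((1 + c) • x) := by rw [smul_smul, inv_mul_cancel₀ h1, one_smul]
  conv_rhs => rw [this]
  rw [div_eq_inv_mul, div_eq_inv_mul, mul_smul, mul_smul, ← smul_add]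
  congr 1
  module

lemma face_card {d : ℕ} (b : AffineBasis (Fin (d + 1)) ℝ (Euc d)) {F : Set (Euc d)}
    (hF : IsFace (convexHull ℝ (Set.range b)) F) :
    (Finset.univ.filter (fun k => b k ∈ F)).card = faceDim F + 1 := by
  set K := Finset.univ.filter (fun k => b k ∈ F) with hK
  have hzero : ∀ x ∈ F, ∀ k ∉ K, b.coord k x = 0 := by
    intro x hx k hk
    have h1 := hF.2.2.2.subset hx
    rw [hull_eq] at h1
    by_contra hne
    exact hk (by simpa [hK] using face_vertex b hF hx (lt_of_le_of_ne (h1 k) (Ne.symm hne)))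
  have hrange : Set.range (fun k : K => b k) = b '' K := by
    ext; simp
  have hspan : affineSpan ℝ F = affineSpan ℝ (Set.range (fun k : K => b k)) := by
    apply le_antisymm
    · rw [affineSpan_le]
      intro x hx
      have h2 : ∑ k ∈ K, b.coord k x = 1 := by
        rw [← b.sum_coord_apply_eq_one x]
        exact Finset.sum_subset (Finset.subset_univ K) fun k _ hk => hzero x hx k hk
      have h1 : x = K.affineCombination ℝ b (fun k => b.coord k x) := by
        rw [Finset.affineCombination_eq_linear_combination _ _ _ h2]
        conv_lhs => rw [← b.linear_combination_coord_eq_self x]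
        refine (Finset.sum_subset (Finset.subset_univ K) fun k _ hk => ?_).symm
        rw [hzero x hx k hk, zero_smul]
      rw [h1, hrange]
      exact affineCombination_mem_affineSpan_image h2 (fun i hi hi' => absurd hi hi') b
    · refine affineSpan_mono ℝ ?_
      rintro _ ⟨k, rfl⟩
      have := k.2
      simpa [hK] using (Finset.mem_filter.1 this).2
  have hKne : K.Nonempty := by
    obtain ⟨x, hx⟩ := hF.1
    by_contra hc
    rw [Finset.not_nonempty_iff_eq_empty] at hc
    have := b.sum_coord_apply_eq_one x
    rw [Finset.sum_eq_zero fun k _ => hzero x hx k (by rw [hc]; simp)] at this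
    exact zero_ne_one this
  obtain ⟨m, hm⟩ : ∃ m, K.card = m + 1 := ⟨K.card - 1, by have := hKne.card_pos; omega⟩
  rw [faceDim, hspan, direction_affineSpan, hm]
  have hai : AffineIndependent ℝ (fun k : K => b k) :=
    b.ind.comp_embedding (Function.Embedding.subtype _)
  rw [hai.finrank_vectorSpan (by rw [Fintype.card_coe, hm])]

lemma face_interior_pos {d : ℕ} (b : AffineBasis (Fin (d + 1)) ℝ (Euc d)) {F : Set (Euc d)}
    (hF : IsFace (convexHull ℝ (Set.range b)) F) {s : Euc d} (hs : s ∈ intrinsicInterior ℝ F)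
    {k : Fin (d + 1)} (hk : b k ∈ F) : 0 < b.coord k s := by
  obtain ⟨s', hs', rfl⟩ := hs
  have hkm : b k ∈ affineSpan ℝ F := subset_affineSpan ℝ F hk
  have hmem : ∀ t : ℝ, (s' : Euc d) + t • (b k - s') ∈ affineSpan ℝ F := by
    intro t
    have := AffineMap.lineMap_mem t s'.2 hkm
    rwa [AffineMap.lineMap_apply, vsub_eq_sub, vadd_eq_add, add_comm] at this
  let g : ℝ → affineSpan ℝ F := fun t => ⟨(s' : Euc d) + t • (b k - s'), hmem t⟩
  have hg : Continuous g := by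
    refine Continuous.subtype_mk ?_ _
    fun_prop
  have hg0 : g 0 = s' := by ext; simp [g]
  have hnhds : ∀ᶠ t in 𝓝 (0 : ℝ), g t ∈ interior ((↑) ⁻¹' F : Set (affineSpan ℝ F)) := by
    apply hg.continuousAt.eventually
    rw [hg0]
    exact isOpen_interior.mem_nhds hs'
  have h2 : ∃ t : ℝ, t < 0 ∧ -1 < t ∧ g t ∈ interior ((↑) ⁻¹' F : Set (affineSpan ℝ F)) := by
    obtain ⟨ε, hε, h⟩ := Metric.eventually_nhds_iff.1 hnhds
    refine ⟨- min (ε / 2) (1 / 2), ?_, ?_, h ?_⟩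
    · have : 0 < min (ε / 2) (1 / 2) := by positivity
      linarith
    · linarith [min_le_right (ε / 2) (1 / 2 : ℝ)]
    · have : 0 < min (ε / 2) (1 / 2) := by positivity
      rw [Real.dist_eq, sub_zero, abs_neg, abs_of_pos this]
      linarith [min_le_left (ε / 2) (1 / 2 : ℝ)]
  obtain ⟨t, ht, ht1, hgt⟩ := h2
  have h3 : (g t : Euc d) ∈ F := by
    have h' := interior_subset hgt
    exact h'
  have h4 := hF.2.2.2.subset h3
  rw [hull_eq] at h4
  have h5 := h4 k
  simp only [g] at h5
  rw [coord_add_smul, b.coord_apply_eq] at h5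
  nlinarith

lemma flag_perm {n : ℕ} (K : Fin (n + 1) → Finset (Fin (n + 1))) (hmono : ∀ i j, i ≤ j → K i ⊆ K j)
    (hcard : ∀ i, (K i).card = (i : ℕ) + 1) :
    ∃ e : Equiv.Perm (Fin (n + 1)), ∀ i k, e.symm k ∈ K i ↔ k ≤ i := by
  have hlast : K (Fin.last n) = Finset.univ := by
    apply Finset.eq_univ_of_card
    rw [hcard]; simp
  have hex : ∀ k, (Finset.univ.filter (fun i => k ∈ K i)).Nonempty := fun k =>
    ⟨Fin.last n, by simp [hlast]⟩
  set r : Fin (n + 1) → Fin (n + 1) := fun k => (Finset.univ.filter (fun i => k ∈ K i)).min' (hex k)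
    with hr
  have hri : ∀ k i, r k ≤ i ↔ k ∈ K i := by
    intro k i
    constructor
    · intro h
      have := Finset.min'_mem _ (hex k)
      exact hmono _ _ h (Finset.mem_filter.1 this).2
    · intro h
      exact Finset.min'_le _ _ (by simpa using h)
  have hsurj : Function.Surjective r := by
    intro i
    refine Fin.cases ?_ (fun j => ?_) i
    · have : (K 0).Nonempty := by rw [← Finset.card_pos, hcard]; omega
      obtain ⟨k, hk⟩ := this
      exact ⟨k, le_antisymm ((hri k 0).2 hk) (Fin.zero_le _)⟩
    · have : ∃ k ∈ K j.succ, k ∉ K j.castSucc := by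
        apply Finset.exists_mem_notMem_of_card_lt_card
        rw [hcard, hcard]; simp
      obtain ⟨k, h1, h2⟩ := this
      refine ⟨k, le_antisymm ((hri _ _).2 h1) ?_⟩
      rw [← hri, not_le] at h2
      exact Fin.castSucc_lt_iff_succ_le.1 h2
  refine ⟨Equiv.ofBijective r (Finite.surjective_iff_bijective.1 hsurj), fun i k => ?_⟩
  rw [← hri]
  have := (Equiv.ofBijective r (Finite.surjective_iff_bijective.1 hsurj)).apply_symm_apply k
  rw [Equiv.ofBijective_apply] at this
  rw [this]

lemma exists_basis {d : ℕ} (v : Fin (d + 1) → Euc d) (hv : AffineIndependent ℝ v) :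
    ∃ b : AffineBasis (Fin (d + 1)) ℝ (Euc d), ∀ i, b i = v i :=
  ⟨⟨v, hv, hv.affineSpan_eq_top_iff_card_eq_finrank_add_one.2 (by simp)⟩, fun _ => rfl⟩

lemma exists_adapted {d : ℕ} (Sig S : Set (Euc d))
    (hSig : IsSimplexSet d Sig) (hS : IsFlagSimplex d Sig S) :
    ∃ b bS : AffineBasis (Fin (d + 1)) ℝ (Euc d), Sig = convexHull ℝ (Set.range b) ∧
      S = convexHull ℝ (Set.range bS) ∧
      (∀ j k, k ≤ j → 0 < b.coord k (bS j)) ∧ (∀ j k, j < k → b.coord k (bS j) = 0) := by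
  obtain ⟨v, hv, rfl⟩ := hSig
  obtain ⟨f, ⟨hf, hmono⟩, s, hs, rfl, hinn⟩ := hS
  obtain ⟨b0, hb0⟩ := exists_basis v hv
  obtain ⟨bS, hbS⟩ := exists_basis s hs
  obtain rfl : (b0 : Fin (d + 1) → Euc d) = v := funext hb0
  obtain rfl : (bS : Fin (d + 1) → Euc d) = s := funext hbS
  obtain ⟨e, he⟩ := flag_perm (fun i => Finset.univ.filter (fun k => b0 k ∈ f i))
    (fun i j hij k hk => by
      simp only [Finset.mem_filter, Finset.mem_univ, true_and] at hk ⊢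
      exact hmono i j hij hk)
    (fun i => by rw [face_card b0 (hf i).1, (hf i).2])
  simp only [Finset.mem_filter, Finset.mem_univ, true_and] at he
  refine ⟨b0.reindex e, bS, ?_, rfl, ?_, ?_⟩
  · congr 1
    rw [AffineBasis.coe_reindex]
    exact (e.symm.surjective.range_comp _).symm
  · intro j k hkj
    rw [AffineBasis.coord_reindex]
    exact face_interior_pos b0 (hf j).1 (hinn j) ((he j k).2 hkj)
  · intro j k hjk
    rw [AffineBasis.coord_reindex]
    have hmem := intrinsicInterior_subset (hinn j)
    have h1 := (hf j).1.2.2.2.subset hmem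
    rw [hull_eq] at h1
    refine le_antisymm (not_lt.1 fun hlt => ?_) (h1 _)
    exact absurd ((he j k).1 (face_vertex b0 (hf j).1 hmem hlt)) (not_le.2 hjk)

lemma mem_asympBall {d : ℕ} (b : AffineBasis (Fin (d + 1)) ℝ (Euc d)) (z x : Euc d) {R : ℝ}
    (hR : 0 < R) :
    x ∈ asympBall (opS b) z R ↔ ∀ k, Real.exp (-2 * R) * b.coord k z < b.coord k x := by
  rw [asympBall, if_pos hR]
  have hlam : 0 < 1 - Real.exp (-2 * R) := by
    rw [sub_pos, Real.exp_lt_one_iff]; linarith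
  constructor
  · rintro ⟨u, hu, rfl⟩ k
    simp only
    rw [coord_add_smul]
    nlinarith [mul_pos hlam (hu k)]
  · intro h
    refine ⟨z + (1 - Real.exp (-2 * R))⁻¹ • (x - z), fun k => ?_, ?_⟩
    · rw [coord_add_smul]
      have hk := h k
      have : b.coord k z + (1 - Real.exp (-2 * R))⁻¹ * (b.coord k x - b.coord k z)
          = (1 - Real.exp (-2 * R))⁻¹ * (b.coord k x - Real.exp (-2 * R) * b.coord k z) := by
        have hne := hlam.ne'
        set E := Real.exp (-2 * R)
        field_simp
        ring
      rw [this]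
      exact mul_pos (inv_pos.2 hlam) (by linarith)
    · simp only [add_sub_cancel_left, smul_smul, mul_inv_cancel₀ hlam.ne', one_smul]
      abel

lemma asympBall_inter {d : ℕ} (b bS : AffineBasis (Fin (d + 1)) ℝ (Euc d)) {z : Euc d}
    (hz : z ∈ opS b) {R : ℝ} (hR : 0 < R) :
    asympBall (opS b) z R ∩ convexHull ℝ (Set.range bS) =
      Phi b '' Areg b bS (fun k => b.coord k z) R := by
  ext x
  rw [mem_inter_iff, mem_asympBall b z x hR, hull_eq]
  constructor
  · rintro ⟨h1, h2⟩
    have hx : x ∈ opS b := fun k => (mul_pos (Real.exp_pos _) (hz k)).trans (h1 k)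
    refine ⟨Psi b x, ⟨fun k => ?_, fun j => ?_⟩, Phi_Psi b hx⟩
    · rw [sm_Psi b hx]; exact h1 k
    · rw [Phi_Psi b hx]; exact h2 j
  · rintro ⟨y, ⟨h1, h2⟩, rfl⟩
    exact ⟨fun k => by rw [coord_Phi]; exact h1 k, h2⟩

lemma volume_scale {d : ℕ} {R : ℝ} (hR : 0 < R) (s : Set (Euc d)) :
    volume s / ENNReal.ofReal (R ^ d) = volume ((fun y : Euc d => R • y) ⁻¹' s) := by
  have hRd : 0 < R ^ d := by positivity
  rw [Measure.addHaar_preimage_smul volume hR.ne', finrank_euclideanSpace_fin,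
    abs_of_pos (inv_pos.2 hRd), ENNReal.ofReal_inv_of_pos hRd, mul_comm, div_eq_mul_inv]

/-- For a flag simplex `S` of a `d`-simplex `Sig` and `z ∈ int Sig`, the limit
`lim_{R→∞} Vol^B(AsB(z,R) ∩ S)/R^d` exists and equals `(1/(d+1)!)·Asvol(Sig)`. -/
theorem flag_simplex_asympVol (d : ℕ) (Sig S : Set (Euc d))
    (hSig : IsSimplexSet d Sig) (hS : IsFlagSimplex d Sig S)
    (z : Euc d) (hz : z ∈ interior Sig) :
    ∀ p ∈ interior Sig,
      Tendsto (fun R : ℝ =>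
          busemannVol (interior Sig) (asympBall (interior Sig) z R ∩ S) /
            ENNReal.ofReal (R ^ d))
        atTop
        (𝓝 (liminf (fun R : ℝ =>
            busemannVol (interior Sig) (hilbertBall (interior Sig) p R) /
              ENNReal.ofReal (R ^ d)) atTop
          / ((Nat.factorial (d + 1) : ℕ) : ℝ≥0∞))) := by
  obtain ⟨b, bS, rfl, rfl, hpos, hzero⟩ := exists_adapted Sig S hSig hS
  have hinn : interior (convexHull ℝ (Set.range b)) = opS b := b.interior_convexHull
  rw [hinn] at hz ⊢
  intro p hp
  set c : ℝ≥0∞ := volume (Metric.ball (0 : Euc d) 1) / volume (Kop d 2) with hc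
  have hcfin : c ≠ ⊤ := ENNReal.div_ne_top measure_ball_lt_top.ne (Kop_pos d)
  have hlim : liminf (fun R : ℝ => busemannVol (opS b) (hilbertBall (opS b) p R) /
      ENNReal.ofReal (R ^ d)) atTop = c * volume (Kcl d 2) := by
    rw [← liminf_const (f := (atTop : Filter ℝ)) (c * volume (Kcl d 2))]
    refine liminf_congr ?_
    filter_upwards [eventually_gt_atTop (0 : ℝ)] with R hR
    have hmeas : MeasurableSet ((fun x => x - Psi b p) ⁻¹' Kcl d (2 * R)) :=
      ((Kcl_isClosed d (2 * R)).preimage (by fun_prop)).measurableSet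
    have hvol : volume ((fun x => x - Psi b p) ⁻¹' Kcl d (2 * R)) = volume (Kcl d (2 * R)) := by
      simp only [sub_eq_add_neg]
      rw [measure_preimage_add_right]
    have hb := hilbertBall_eq b (Psi b p) hR.le
    rw [Phi_Psi b hp] at hb
    rw [hb, busemannVol_image b _ hmeas, hvol, mul_div_assoc, volume_scale hR]
    congr 2
    ext y
    simp only [mem_preimage, Kcl, mem_ofPred_eq, map_smul, smul_eq_mul, ← mul_sub]
    refine forall_congr' fun i => forall_congr' fun j => ?_
    rw [mul_comm 2 R]
    exact mul_le_mul_iff_of_pos_left hR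
  rw [hlim, volume_Kcl]
  have hfac : ((Nat.factorial (d + 1) : ℕ) : ℝ≥0∞) ≠ 0 := by
    exact_mod_cast (Nat.factorial_pos (d + 1)).ne'
  have hval : c * (((Nat.factorial (d + 1) : ℕ) : ℝ≥0∞) * volume (Tcell d)) /
      ((Nat.factorial (d + 1) : ℕ) : ℝ≥0∞) = c * volume (Tcell d) := by
    rw [mul_left_comm, mul_comm]
    exact ENNReal.mul_div_cancel_right hfac (ENNReal.natCast_ne_top _)
  rw [hval]
  have ht := ENNReal.Tendsto.const_mul
    (tendsto_volume_Areg b bS hpos hzero (fun k => b.coord k z) hz) (Or.inr hcfin)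
  refine ht.congr' ?_
  filter_upwards [eventually_gt_atTop (0 : ℝ)] with R hR
  rw [asympBall_inter b bS hz hR, busemannVol_image b _ (Areg_meas b bS _ R), mul_div_assoc,
    volume_scale hR]

end
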